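/- Suppose that ρ̂ = ρ + αλ_min − ζ̃_{L*−K} ≥ 0. Then the set-valued operator A + C + D_K (x ↦ {u + Cx + D_K x : u ∈ A x}) is maximally monotone. -/

import Mathlib

open Filter Topology
open scoped RealInnerProductSpace Pointwise

noncomputable section

variable {H G : Type*}

/-- A set-valued operator `A` is `ρ`-monotone. -/
def IsMonotoneSV [NormedAddCommGroup H] [InnerProductSpace ℝ H]
    (ρ : ℝ) (A : H → Set H) : Prop :=
  ∀ x y u v, u ∈ A x → v ∈ A y → ρ * ‖x - y‖ ^ 2 ≤ ⟪x - y, u - v⟫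

/-- `A` is maximally `ρ`-monotone: it is `ρ`-monotone and its graph is maximal, under
inclusion, among graphs of `ρ`-monotone operators. -/
def IsMaxMonotoneSV [NormedAddCommGroup H] [InnerProductSpace ℝ H]
    (ρ : ℝ) (A : H → Set H) : Prop :=
  IsMonotoneSV ρ A ∧
    ∀ A' : H → Set H, IsMonotoneSV ρ A' → (∀ x, A x ⊆ A' x) → ∀ x, A' x = A x

/-- `C` is `β`-cocoercive. -/
def IsCocoercive [NormedAddCommGroup H] [InnerProductSpace ℝ H]
    (β : ℝ) (C : H → H) : Prop :=
  ∀ x y, β * ‖C x - C y‖ ^ 2 ≤ ⟪x - y, C x - C y⟫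

/-- `k` is a Lipschitz bound for `f`. -/
def IsLipBound {E F : Type*} [NormedAddCommGroup E] [NormedAddCommGroup F]
    (k : ℝ) (f : E → F) : Prop :=
  ∀ x y, ‖f x - f y‖ ≤ k * ‖x - y‖

/-- `k` is the (smallest) Lipschitz constant of `f`. -/
def IsLipConst {E F : Type*} [NormedAddCommGroup E] [NormedAddCommGroup F]
    (k : ℝ) (f : E → F) : Prop :=
  IsLipBound k f ∧ ∀ k', IsLipBound k' f → k ≤ k'

/-- A single-valued map `B` is monotone. -/
def IsMonotoneMap [NormedAddCommGroup G] [InnerProductSpace ℝ G]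
    (B : G → G) : Prop :=
  ∀ x y, (0:ℝ) ≤ ⟪x - y, B x - B y⟫

/-- The operator `D_M : x ↦ α M (L x - c) + M (B (L x))`. -/
def Dop [NormedAddCommGroup H] [InnerProductSpace ℝ H]
    [NormedAddCommGroup G] [InnerProductSpace ℝ G]
    (α : ℝ) (L : H →L[ℝ] G) (c : G) (B : G → G) (M : G →L[ℝ] H) : H → H :=
  fun x => α • M (L x - c) + M (B (L x))

/-- `λ_min = inf {⟪x, K (L x)⟫ : ‖x‖ = 1}`. -/
def lambdaMin [NormedAddCommGroup H] [InnerProductSpace ℝ H]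
    [NormedAddCommGroup G] [InnerProductSpace ℝ G]
    (L : H →L[ℝ] G) (K : G →L[ℝ] H) : ℝ :=
  sInf {r : ℝ | ∃ x : H, ‖x‖ = 1 ∧ r = ⟪x, K (L x)⟫}

/-- The step-size bound `χ`. -/
def chiConst (β ρ κ : ℝ) : ℝ :=
  if 0 ≤ ρ then 4 * β / (1 + Real.sqrt (1 + 16 * β ^ 2 * κ ^ 2))
  else min (4 * β / (1 + Real.sqrt (1 + 16 * β ^ 2 * κ ^ 2))) (-1 / ρ)


/-- A nonempty closed convex subset of `V × ℝ` on which `t + ‖p‖² / 2` is bounded below contains a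
minimizer of that function; the conclusion is the first-order optimality condition. -/
theorem exists_forall_add_inner_le {V : Type*} [NormedAddCommGroup V] [InnerProductSpace ℝ V]
    [CompleteSpace V] {E : Set (V × ℝ)} (hne : E.Nonempty) (hcl : IsClosed E)
    (hconv : Convex ℝ E) {b : ℝ} (hb : ∀ q ∈ E, b ≤ q.2 + ‖q.1‖ ^ 2 / 2) :
    ∃ p ∈ E, ∀ q ∈ E, p.2 + ‖p.1‖ ^ 2 ≤ q.2 + ⟪p.1, q.1⟫ := by
  set f : V × ℝ → ℝ := fun q => q.2 + ‖q.1‖ ^ 2 / 2 with hf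
  have hbdd : BddBelow (f '' E) := ⟨b, by rintro _ ⟨q, hq, rfl⟩; exact hb q hq⟩
  set m := sInf (f '' E) with hm
  have hmle : ∀ q ∈ E, m ≤ f q := fun q hq => csInf_le hbdd ⟨q, hq, rfl⟩
  have hex : ∀ n : ℕ, ∃ q ∈ E, f q < m + 1 / ((n : ℝ) + 1) := by
    intro n
    obtain ⟨_, ⟨q, hq, rfl⟩, hlt⟩ := exists_lt_of_csInf_lt (hne.image f)
      (show sInf (f '' E) < m + 1 / ((n : ℝ) + 1) from lt_add_of_pos_right _ (by positivity))
    exact ⟨q, hq, hlt⟩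
  choose q hqE hq using hex
  have hsq : ∀ v w : V, ‖(1 / 2 : ℝ) • v + (1 / 2 : ℝ) • w‖ ^ 2 =
      ‖v‖ ^ 2 / 2 + ‖w‖ ^ 2 / 2 - ‖v - w‖ ^ 2 / 4 := by
    intro v w
    rw [norm_add_sq_real, norm_sub_sq_real, norm_smul, norm_smul, inner_smul_left,
      inner_smul_right]
    norm_num
    ring
  have hdist : ∀ i j, ‖(q i).1 - (q j).1‖ ^ 2 ≤
      4 * (1 / ((i : ℝ) + 1) + 1 / ((j : ℝ) + 1)) := by
    intro i j
    have h := hmle _ (hconv (hqE i) (hqE j) (by norm_num : (0 : ℝ) ≤ 1 / 2)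
      (by norm_num : (0 : ℝ) ≤ 1 / 2) (by norm_num))
    have hi := hq i
    have hj := hq j
    simp only [hf, Prod.fst_add, Prod.snd_add, Prod.smul_fst, Prod.smul_snd, hsq,
      smul_eq_mul] at h hi hj
    linarith
  have hcauchy : CauchySeq fun n => (q n).1 := by
    rw [Metric.cauchySeq_iff]
    intro ε hε
    obtain ⟨N, hN⟩ := exists_nat_one_div_lt (show (0 : ℝ) < ε ^ 2 / 8 by positivity)
    refine ⟨N, fun i hi j hj => ?_⟩
    have h1 : 1 / ((i : ℝ) + 1) ≤ 1 / ((N : ℝ) + 1) := Nat.one_div_le_one_div hi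
    have h2 : 1 / ((j : ℝ) + 1) ≤ 1 / ((N : ℝ) + 1) := Nat.one_div_le_one_div hj
    rw [dist_eq_norm]
    exact lt_of_pow_lt_pow_left₀ 2 hε.le (by linarith [hdist i j])
  obtain ⟨p, hp⟩ := cauchySeq_tendsto_of_complete hcauchy
  have hfm : Tendsto (fun n => f (q n)) atTop (𝓝 m) := by
    refine tendsto_of_tendsto_of_tendsto_of_le_of_le tendsto_const_nhds ?_
      (fun n => hmle _ (hqE n)) (fun n => (hq n).le)
    simpa using tendsto_const_nhds.add (tendsto_one_div_add_atTop_nhds_zero_nat (𝕜 := ℝ))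
  have ht : Tendsto (fun n => (q n).2) atTop (𝓝 (m - ‖p‖ ^ 2 / 2)) := by
    refine (hfm.sub ((hp.norm.pow 2).div_const 2)).congr fun n => ?_
    simp [hf]
  have hpE : (p, m - ‖p‖ ^ 2 / 2) ∈ E :=
    hcl.mem_of_tendsto (hp.prodMk_nhds ht) (Eventually.of_forall hqE)
  refine ⟨_, hpE, fun r hr => ?_⟩
  have hstep : ∀ s : ℝ, 0 < s → s ≤ 1 →
      0 ≤ r.2 - m + ‖p‖ ^ 2 / 2 + ⟪p, r.1 - p⟫ + s * (‖r.1 - p‖ ^ 2 / 2) := by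
    intro s hs hs1
    have h := hmle _ (hconv.add_smul_sub_mem hpE hr ⟨hs.le, hs1⟩)
    simp only [hf, Prod.fst_add, Prod.snd_add, Prod.smul_fst, Prod.smul_snd, Prod.fst_sub,
      Prod.snd_sub, smul_eq_mul, norm_add_sq_real, inner_smul_right, norm_smul, mul_pow,
      Real.norm_eq_abs, sq_abs] at h
    refine nonneg_of_mul_nonneg_right (a := s) (by linarith) hs
  have hlim : Tendsto (fun s : ℝ => r.2 - m + ‖p‖ ^ 2 / 2 + ⟪p, r.1 - p⟫ +
      s * (‖r.1 - p‖ ^ 2 / 2)) (𝓝[>] 0)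
      (𝓝 (r.2 - m + ‖p‖ ^ 2 / 2 + ⟪p, r.1 - p⟫ + 0 * (‖r.1 - p‖ ^ 2 / 2))) :=
    (Continuous.tendsto (by fun_prop) 0).mono_left nhdsWithin_le_nhds
  have h := ge_of_tendsto hlim (by
    filter_upwards [Ioc_mem_nhdsGT (zero_lt_one (α := ℝ))] with s hs using hstep s hs.1 hs.2)
  rw [inner_sub_right, real_inner_self_eq_norm_sq] at h
  linarith

/-- **Minty's theorem** for a maximally monotone relation `P`: `0` lies in the range of
`Id + P`. -/
theorem exists_rel_neg_self {H : Type*} [NormedAddCommGroup H] [InnerProductSpace ℝ H]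
    [CompleteSpace H] {P : H → H → Prop}
    (hmono : ∀ x u y v, P x u → P y v → 0 ≤ ⟪x - y, u - v⟫)
    (hmax : ∀ x u, (∀ y v, P y v → 0 ≤ ⟪x - y, u - v⟫) → P x u) : ∃ x, P x (-x) := by
  obtain ⟨y₀, v₀, h₀⟩ : ∃ y v, P y v := by
    by_contra! h
    exact h 0 0 (hmax 0 0 fun y v hyv => (h y v hyv).elim)
  -- the epigraph of the Fitzpatrick function of `P`
  let E : Set (WithLp 2 (H × H) × ℝ) :=
    {q | ∀ y v, P y v → ⟪q.1.fst, v⟫ + ⟪y, q.1.snd⟫ - ⟪y, v⟫ ≤ q.2}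
  have hgraph : ∀ y v, P y v → (WithLp.toLp 2 (y, v), ⟪y, v⟫) ∈ E := by
    intro x u hxu y v hyv
    have := hmono x u y v hxu hyv
    simp only [inner_sub_left, inner_sub_right] at this
    change ⟪x, v⟫ + ⟪y, u⟫ - ⟪y, v⟫ ≤ ⟪x, u⟫
    linarith
  have hE : ∀ q ∈ E, ⟪q.1.fst, q.1.snd⟫ ≤ q.2 := by
    intro q hq
    by_cases hP : P q.1.fst q.1.snd
    · have := hq _ _ hP
      linarith
    · obtain ⟨y, v, hyv, hlt⟩ : ∃ y v, P y v ∧ ⟪q.1.fst - y, q.1.snd - v⟫ < 0 := by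
        by_contra! h
        exact hP (hmax _ _ h)
      have := hq y v hyv
      simp only [inner_sub_left, inner_sub_right] at hlt
      linarith
  have hcl : IsClosed E := by
    simp only [E, Set.ofPred_forall]
    refine isClosed_iInter fun y => isClosed_iInter fun v => isClosed_iInter fun _ =>
      isClosed_le ?_ continuous_snd
    have h1 : Continuous fun q : WithLp 2 (H × H) × ℝ => q.1.fst :=
      (WithLp.continuous_fst ..).comp continuous_fst
    have h2 : Continuous fun q : WithLp 2 (H × H) × ℝ => q.1.snd :=
      (WithLp.continuous_snd ..).comp continuous_fst
    fun_prop
  have hconv : Convex ℝ E := by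
    intro q hq r hr a b ha hb hab y v hyv
    have h1 := mul_le_mul_of_nonneg_left (hq y v hyv) ha
    have h2 := mul_le_mul_of_nonneg_left (hr y v hyv) hb
    simp only [Prod.fst_add, Prod.snd_add, Prod.smul_fst, Prod.smul_snd, WithLp.add_fst,
      WithLp.add_snd, WithLp.smul_fst, WithLp.smul_snd, inner_add_left, inner_add_right,
      inner_smul_left, inner_smul_right, smul_eq_mul, RCLike.conj_to_real]
    have h3 : ⟪y, v⟫ = a * ⟪y, v⟫ + b * ⟪y, v⟫ := by rw [← add_mul, hab, one_mul]
    linarith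
  have hsum : ∀ x u : H, ‖x + u‖ ^ 2 = ‖x‖ ^ 2 + ‖u‖ ^ 2 + 2 * ⟪x, u⟫ := by
    intro x u
    rw [norm_add_sq_real]
    ring
  obtain ⟨p, hpE, hp⟩ := exists_forall_add_inner_le (b := 0) ⟨_, hgraph y₀ v₀ h₀⟩ hcl hconv (by
    intro q hq
    have h1 := hE q hq
    have h2 := hsum q.1.fst q.1.snd
    have h3 := sq_nonneg ‖q.1.fst + q.1.snd‖
    rw [WithLp.prod_norm_sq_eq_of_L2]
    linarith)
  set x := p.1.fst
  set u := p.1.snd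
  have key : ∀ y v, P y v → ‖x + u‖ ^ 2 ≤ ⟪-u - y, -x - v⟫ := by
    intro y v hyv
    have h1 := hp _ (hgraph y v hyv)
    have h2 : ⟪x, u⟫ ≤ p.2 := hE p hpE
    have h3 : ‖p.1‖ ^ 2 = ‖x‖ ^ 2 + ‖u‖ ^ 2 := WithLp.prod_norm_sq_eq_of_L2 _
    have h4 : ⟪p.1, WithLp.toLp 2 (y, v)⟫ = ⟪x, y⟫ + ⟪u, v⟫ := WithLp.prod_inner_apply _ _
    simp only [h3, h4] at h1
    rw [hsum]
    simp only [inner_sub_left, inner_sub_right, inner_neg_left, inner_neg_right]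
    have h5 := real_inner_comm x u
    have h6 := real_inner_comm x y
    linarith
  have hP : P (-u) (-x) := hmax _ _ fun y v hyv => (sq_nonneg _).trans (key y v hyv)
  have hz : ‖x + u‖ ^ 2 ≤ 0 := by simpa using key _ _ hP
  have hxu : x + u = 0 := by
    rw [← norm_eq_zero]
    exact pow_eq_zero_iff two_ne_zero |>.1 (le_antisymm hz (sq_nonneg _))
  have hux : -u = x := (eq_neg_of_add_eq_zero_left hxu).symm
  exact ⟨x, hux ▸ hP⟩

section

variable {H : Type*} [NormedAddCommGroup H] [InnerProductSpace ℝ H]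

/-- A point monotonically related to the graph of a maximally `ρ`-monotone operator belongs to
it. -/
theorem IsMaxMonotoneSV.mem_of_forall {ρ : ℝ} {A : H → Set H} (hA : IsMaxMonotoneSV ρ A)
    {x u : H} (h : ∀ y v, v ∈ A y → ρ * ‖x - y‖ ^ 2 ≤ ⟪x - y, u - v⟫) : u ∈ A x := by
  rw [← hA.2 (fun z => A z ∪ {s | z = x ∧ s = u}) ?_ (fun z => Set.subset_union_left) x]
  · exact Or.inr ⟨rfl, rfl⟩
  · rintro y z s t (hs | ⟨rfl, rfl⟩) (ht | ⟨rfl, rfl⟩)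
    · exact hA.1 y z s t hs ht
    · have := h y s hs
      rwa [norm_sub_rev, ← neg_sub y, ← neg_sub s, inner_neg_neg] at this
    · exact h z t ht
    · simp

theorem IsMaxMonotoneSV.exists_sub_smul_mem [CompleteSpace H] {ρ : ℝ} {A : H → Set H}
    (hA : IsMaxMonotoneSV ρ A) {μ : ℝ} (hμ : 0 < μ + ρ) (x w : H) :
    ∃ z, w - μ • z ∈ A (x + z) := by
  obtain ⟨z, hz⟩ := exists_rel_neg_self
    (P := fun z s => (μ + ρ) • s + ρ • z + w ∈ A (x + z)) (by
      intro z s z' s' h h'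
      have key := hA.1 _ _ _ _ h h'
      rw [show x + z - (x + z') = z - z' by abel,
        show (μ + ρ) • s + ρ • z + w - ((μ + ρ) • s' + ρ • z' + w) =
          (μ + ρ) • (s - s') + ρ • (z - z') by module,
        inner_add_right, inner_smul_right, inner_smul_right, real_inner_self_eq_norm_sq] at key
      exact nonneg_of_mul_nonneg_right (a := μ + ρ) (by linarith) hμ) (by
      intro z s h
      refine hA.mem_of_forall fun y v hv => ?_
      set s' := (μ + ρ)⁻¹ • (v - ρ • (y - x) - w) with hs'
      have hv' : v = (μ + ρ) • s' + ρ • (y - x) + w := by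
        rw [hs', smul_inv_smul₀ hμ.ne']
        abel
      have key := mul_nonneg hμ.le (h (y - x) s' (by
        rw [← hv', add_sub_cancel]
        exact hv))
      rw [show x + z - y = z - (y - x) by abel, hv',
        show (μ + ρ) • s + ρ • z + w - ((μ + ρ) • s' + ρ • (y - x) + w) =
          (μ + ρ) • (s - s') + ρ • (z - (y - x)) by module,
        inner_add_right, inner_smul_right, inner_smul_right, real_inner_self_eq_norm_sq]
      linarith)
  refine ⟨z, ?_⟩
  convert hz using 1
  module

/-- Adding a Lipschitzian map `T` to a maximally `ρ`-monotone operator gives a maximally monotone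
operator as soon as `T + ρ Id` is monotone. -/
theorem IsMaxMonotoneSV.image_add [CompleteSpace H] {ρ k : ℝ} {A : H → Set H} {T : H → H}
    (hA : IsMaxMonotoneSV ρ A) (hT : IsLipBound k T)
    (hmono : ∀ x y, 0 ≤ ρ * ‖x - y‖ ^ 2 + ⟪x - y, T x - T y⟫) :
    IsMaxMonotoneSV 0 fun x => (fun u => u + T x) '' A x := by
  refine ⟨?_, fun A' hA' hsub x => (Set.Subset.antisymm ?_ (hsub x))⟩
  · rintro x y _ _ ⟨u, hu, rfl⟩ ⟨v, hv, rfl⟩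
    have h1 := hA.1 x y u v hu hv
    have h2 := hmono x y
    rw [add_sub_add_comm, inner_add_right]
    linarith
  · intro u hu
    set μ := |k| + |ρ| + 1 with hμ
    have hμρ : 0 < μ + ρ := by linarith [abs_nonneg k, neg_abs_le ρ]
    obtain ⟨z, hz⟩ := hA.exists_sub_smul_mem hμρ x (u - T x)
    have h := hA' _ _ _ _ hu (hsub (x + z) ⟨_, hz, rfl⟩)
    have hcs := real_inner_le_norm z (T (x + z) - T x)
    have hlip : ‖T (x + z) - T x‖ ≤ k * ‖z‖ := by simpa using hT (x + z) x
    have hmul := mul_le_mul_of_nonneg_left hlip (norm_nonneg z)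
    simp only at h
    rw [show x - (x + z) = -z by abel,
      show u - (u - T x - μ • z + T (x + z)) = μ • z - (T (x + z) - T x) by abel,
      inner_neg_left, inner_sub_right, inner_smul_right, real_inner_self_eq_norm_sq] at h
    have hz0 : (μ - k) * ‖z‖ ^ 2 ≤ 0 := by nlinarith
    have hμk : 0 < μ - k := by linarith [le_abs_self k, abs_nonneg ρ]
    have hz1 : ‖z‖ ^ 2 = 0 :=
      le_antisymm (nonpos_of_mul_nonpos_right hz0 hμk) (sq_nonneg _)
    obtain rfl : z = 0 := by simpa using hz1
    exact ⟨u - T x, by simpa using hz, by simp⟩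

theorem IsCocoercive.isLipBound {β : ℝ} {C : H → H} (hβ : 0 < β) (hC : IsCocoercive β C) :
    IsLipBound β⁻¹ C := by
  intro x y
  have h := (hC x y).trans (real_inner_le_norm _ _)
  rw [inv_mul_eq_div, le_div_iff₀ hβ]
  rcases (norm_nonneg (C x - C y)).eq_or_lt with h0 | h0
  · rw [← h0]
    simp
  · refine le_of_mul_le_mul_right ?_ h0
    linarith

theorem lambdaMin_mul_norm_sq_le {G : Type*} [NormedAddCommGroup G] [InnerProductSpace ℝ G]
    (L : H →L[ℝ] G) (K : G →L[ℝ] H) (x : H) :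
    lambdaMin L K * ‖x‖ ^ 2 ≤ ⟪x, K (L x)⟫ := by
  rcases eq_or_ne x 0 with rfl | hx
  · simp
  have hx' : 0 < ‖x‖ := norm_pos_iff.2 hx
  have hbdd : BddBelow {r : ℝ | ∃ x : H, ‖x‖ = 1 ∧ r = ⟪x, K (L x)⟫} := by
    refine ⟨-‖K.comp L‖, ?_⟩
    rintro _ ⟨y, hy, rfl⟩
    have h1 := (abs_le.1 (abs_real_inner_le_norm y (K (L y)))).1
    have h2 := (K.comp L).le_opNorm y
    simp only [hy, one_mul, mul_one, ContinuousLinearMap.comp_apply] at h1 h2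
    linarith
  have h : lambdaMin L K ≤ ⟪‖x‖⁻¹ • x, K (L (‖x‖⁻¹ • x))⟫ :=
    csInf_le hbdd ⟨‖x‖⁻¹ • x, norm_smul_inv_norm hx, rfl⟩
  simp only [map_smul, inner_smul_left, inner_smul_right, RCLike.conj_to_real] at h
  calc lambdaMin L K * ‖x‖ ^ 2 ≤ ‖x‖⁻¹ * (‖x‖⁻¹ * ⟪x, K (L x)⟫) * ‖x‖ ^ 2 := by gcongr
    _ = ⟪x, K (L x)⟫ := by field_simp

end

section

variable {H G : Type*} [NormedAddCommGroup H] [InnerProductSpace ℝ H]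
  [NormedAddCommGroup G] [InnerProductSpace ℝ G]

theorem Dop_sub_Dop (α : ℝ) (L : H →L[ℝ] G) (c : G) (B : G → G) (M : G →L[ℝ] H) (x y : H) :
    Dop α L c B M x - Dop α L c B M y = α • M (L (x - y)) + M (B (L x) - B (L y)) := by
  simp only [Dop, map_sub]
  module

theorem isLipBound_Dop {α ζ : ℝ} (hα : 0 ≤ α) (hζ : 0 ≤ ζ) (L : H →L[ℝ] G) (c : G) {B : G → G}
    (hB : IsLipBound ζ B) (M : G →L[ℝ] H) :
    IsLipBound (α * (‖M‖ * ‖L‖) + ‖M‖ * (ζ * ‖L‖)) (Dop α L c B M) := by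
  intro x y
  have hL := L.le_opNorm (x - y)
  have h1 : ‖M (L (x - y))‖ ≤ ‖M‖ * (‖L‖ * ‖x - y‖) := M.le_opNorm_of_le hL
  have h2 : ‖B (L x) - B (L y)‖ ≤ ζ * (‖L‖ * ‖x - y‖) := by
    refine (hB _ _).trans ?_
    rw [← map_sub]
    gcongr
  have h3 : ‖M (B (L x) - B (L y))‖ ≤ ‖M‖ * (ζ * (‖L‖ * ‖x - y‖)) := M.le_opNorm_of_le h2
  rw [Dop_sub_Dop]
  calc _ ≤ ‖α • M (L (x - y))‖ + ‖M (B (L x) - B (L y))‖ := norm_add_le _ _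
    _ ≤ α * (‖M‖ * (‖L‖ * ‖x - y‖)) + ‖M‖ * (ζ * (‖L‖ * ‖x - y‖)) := by
      rw [norm_smul, Real.norm_of_nonneg hα]
      gcongr
    _ = _ := by ring

theorem le_inner_Dop_sub_Dop [CompleteSpace H] [CompleteSpace G] {α ζt : ℝ} (hα : 0 ≤ α)
    (L : H →L[ℝ] G) (K : G →L[ℝ] H) (c : G) {B : G → G} (hB : IsMonotoneMap B)
    (hζt : IsLipBound ζt fun x : H => (ContinuousLinearMap.adjoint L - K) (B (L x))) (x y : H) :
    (α * lambdaMin L K - ζt) * ‖x - y‖ ^ 2 ≤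
      ⟪x - y, Dop α L c B K x - Dop α L c B K y⟫ := by
  have h1 := mul_le_mul_of_nonneg_left (lambdaMin_mul_norm_sq_le L K (x - y)) hα
  have h2 := hB (L x) (L y)
  have h3 := (real_inner_le_norm (x - y) _).trans
    (mul_le_mul_of_nonneg_left (hζt x y) (norm_nonneg (x - y)))
  simp only [← map_sub, sub_apply (ContinuousLinearMap.adjoint L),
    inner_sub_right, ContinuousLinearMap.adjoint_inner_right] at h2 h3
  rw [Dop_sub_Dop, inner_add_right, inner_smul_right]
  simp only [map_sub, inner_sub_right] at h1 h2 h3 ⊢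
  linarith

end

theorem statement1 {H G : Type*} [NormedAddCommGroup H] [InnerProductSpace ℝ H] [CompleteSpace H]
    [NormedAddCommGroup G] [InnerProductSpace ℝ G] [CompleteSpace G]
    (ρ β ζ α : ℝ) (A : H → Set H) (C : H → H) (B : G → G)
    (L : H →L[ℝ] G) (K : G →L[ℝ] H) (c : G)
    (hA : IsMaxMonotoneSV ρ A)
    (hβ : 0 < β) (hC : IsCocoercive β C)
    (hζ : 0 < ζ) (hBmono : IsMonotoneMap B) (hBlip : IsLipBound ζ B)
    (hα : 0 ≤ α)
    (ζt : ℝ)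
    (hζt : IsLipConst ζt (fun x : H => (ContinuousLinearMap.adjoint L - K) (B (L x))))
    (hρhat : 0 ≤ (ρ + α * lambdaMin L K - ζt)) :
    IsMaxMonotoneSV 0 (fun x => (fun u => u + C x + Dop α L c B K x) '' A x) := by
  have hLip : IsLipBound (β⁻¹ + (α * (‖K‖ * ‖L‖) + ‖K‖ * (ζ * ‖L‖)))
      (fun x => C x + Dop α L c B K x) := by
    intro x y
    rw [add_sub_add_comm, add_mul]
    exact norm_add_le_of_le (hC.isLipBound hβ x y) (isLipBound_Dop hα hζ.le L c hBlip K x y)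
  have hmono : ∀ x y, 0 ≤ ρ * ‖x - y‖ ^ 2 +
      ⟪x - y, (C x + Dop α L c B K x) - (C y + Dop α L c B K y)⟫ := by
    intro x y
    have h1 := le_inner_Dop_sub_Dop hα L K c hBmono hζt.1 x y
    have h2 : 0 ≤ ⟪x - y, C x - C y⟫ := (by positivity : 0 ≤ β * ‖C x - C y‖ ^ 2).trans (hC x y)
    have h3 := mul_nonneg hρhat (sq_nonneg ‖x - y‖)
    rw [add_sub_add_comm, inner_add_right]
    linarith
  simpa only [add_assoc] using hA.image_add hLip hmono
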